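/- Let n ≥ 1, let D be a real n×n diagonal matrix with diagonal entries d_k > 0, let τ > 0, and let F ∈ ℝⁿ have all components strictly positive. Set C_k = (∑_j F_j)/d_k and 𝒞 = { P ∈ ℝⁿ : 0 ≤ P_k ≤ C_k for all k }. Suppose Ã is a function from ℝⁿ to real n×n matrices that is continuous on 𝒞 and such that for every P ∈ 𝒞 the matrix Ã(P) has nonpositive off-diagonal entries and nonnegative column sums. Then there exists P* ∈ 𝒞 such that (D + τÃ(P*))P* = F and 0 < P*_k ≤ C_k for every k. -/

import Mathlib

open Matrix BigOperators

/-- The closed box `∏_k [0, c_k]` in `ℝⁿ`. -/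
def box (n : ℕ) (c : Fin n → ℝ) : Set (Fin n → ℝ) :=
  {P | ∀ k, 0 ≤ P k ∧ P k ≤ c k}

section Dominance

variable {V I α : Type*} [LinearOrder α]

/-- A finite set `S` is dominant for a family of utilities if no point beats,
for every utility, the worst element of `S`. -/
def Dominant (u : I → V → α) (S : Finset V) : Prop :=
  ∀ y, ∃ i, ∀ x ∈ S, u i y ≤ u i x

theorem Dominant.mono {u : I → V → α} {S T : Finset V} (hT : Dominant u T) (h : S ⊆ T) :
    Dominant u S := fun y =>
  let ⟨i, hi⟩ := hT y
  ⟨i, fun x hx => hi x (h hx)⟩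

variable [DecidableEq V] [Fintype I] [DecidableEq I]

open Classical in
/-- A dominant set with one element fewer than there are utilities has exactly two dominant
one-point extensions, unless some utility bars an extension. -/
theorem Dominant.card_extensions_eq_two [Fintype V] {u : I → V → α} (hu : ∀ i, Function.Injective (u i))
    {d : Finset V} (hd : Dominant u d) (hne : d.Nonempty) (hcard : d.card + 1 = Fintype.card I)
    (hM : ∀ i, ∃ y, ∀ l, l ≠ i → ∃ x ∈ d, u l x < u l y) :
    (Finset.univ.filter fun y => y ∉ d ∧ Dominant u (insert y d)).card = 2 := by
  choose mn hmem hmin using fun i => Finset.exists_min_image d (u i) hne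
  have hmn : ∀ i, ∀ x ∈ d, (∀ z ∈ d, u i x ≤ u i z) → mn i = x := fun i x hx h =>
    hu i (le_antisymm (hmin i x hx) (h _ (hmem i)))
  have hsurj : ∀ x ∈ d, ∃ i, mn i = x := fun x hx => by
    obtain ⟨i, hi⟩ := hd x
    exact ⟨i, hmn i x hx hi⟩
  have hinj : ∀ i, (∀ x ∈ d, ∃ l, l ≠ i ∧ mn l = x) →
      ∀ a b, a ≠ i → b ≠ i → mn a = mn b → a = b := by
    intro i h a b ha hb hab
    have himg : (Finset.univ.erase i).image mn = d := by
      ext x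
      simp only [Finset.mem_image, Finset.mem_erase, Finset.mem_univ, and_true]
      exact ⟨fun ⟨l, _, hl⟩ => hl ▸ hmem l, h x⟩
    have hc : ((Finset.univ.erase i).image mn).card = (Finset.univ.erase i).card := by
      rw [himg, Finset.card_erase_of_mem (Finset.mem_univ i), Finset.card_univ]; omega
    exact Finset.card_image_iff.mp hc (by simpa using ha) (by simpa using hb) hab
  obtain ⟨j, k, hjk, hmjk⟩ : ∃ j k, j ≠ k ∧ mn j = mn k := by
    obtain ⟨j, -, k, -, h1, h2⟩ := Finset.exists_ne_map_eq_of_card_lt_of_maps_to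
      (s := (Finset.univ : Finset I)) (t := d) (f := mn) (by rw [Finset.card_univ]; omega)
      (fun i _ => hmem i)
    exact ⟨j, k, h1, h2⟩
  have hsurjj : ∀ x ∈ d, ∃ l, l ≠ j ∧ mn l = x := fun x hx => by
    obtain ⟨l, hl⟩ := hsurj x hx
    by_cases h : l = j
    · exact ⟨k, hjk.symm, by rw [← hmjk, ← h, hl]⟩
    · exact ⟨l, h, hl⟩
  have hsurjk : ∀ x ∈ d, ∃ l, l ≠ k ∧ mn l = x := fun x hx => by
    obtain ⟨l, hl⟩ := hsurj x hx
    by_cases h : l = k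
    · exact ⟨j, hjk, by rw [hmjk, ← h, hl]⟩
    · exact ⟨l, h, hl⟩
  have hM' : ∀ i, ∃ y, (∀ l, l ≠ i → u l (mn l) < u l y) ∧
      ∀ z, (∀ l, l ≠ i → u l (mn l) < u l z) → u i z ≤ u i y := by
    intro i
    obtain ⟨y, hy⟩ := hM i
    obtain ⟨m, hm, hmax⟩ := Finset.exists_max_image
      (Finset.univ.filter fun y => ∀ l, l ≠ i → u l (mn l) < u l y) (u i)
      ⟨y, by
        simp only [Finset.mem_filter, Finset.mem_univ, true_and]
        intro l hl
        obtain ⟨x, hx, hxy⟩ := hy l hl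
        exact (hmin l x hx).trans_lt hxy⟩
    simp only [Finset.mem_filter, Finset.mem_univ, true_and] at hm hmax
    exact ⟨m, hm, hmax⟩
  choose top htop htopmax using hM'
  have hext : ∀ i, (∀ x ∈ d, ∃ l, l ≠ i ∧ mn l = x) →
      top i ∉ d ∧ Dominant u (insert (top i) d) := by
    intro i hi
    have hle : ∀ x ∈ d, u i (top i) ≤ u i x := by
      obtain ⟨l, hl⟩ := hd (top i)
      by_cases h : l = i
      · exact h ▸ hl
      · exact absurd (hl _ (hmem l)) (not_le.mpr (htop i l h))
    refine ⟨fun h => ?_, fun z => ?_⟩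
    · obtain ⟨l, hl, hx⟩ := hi _ h
      exact absurd (htop i l hl) (by rw [hx]; exact lt_irrefl _)
    · by_cases hz : ∀ l, l ≠ i → u l (mn l) < u l z
      · refine ⟨i, fun x hx => ?_⟩
        rcases Finset.mem_insert.mp hx with rfl | hx
        · exact htopmax i z hz
        · exact (htopmax i z hz).trans (hle x hx)
      · push Not at hz
        obtain ⟨l, hl, hlz⟩ := hz
        refine ⟨l, fun x hx => ?_⟩
        rcases Finset.mem_insert.mp hx with rfl | hx
        · exact hlz.trans (htop i l hl).le
        · exact hlz.trans (hmin l x hx)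
  have htopne : top j ≠ top k := by
    intro h
    obtain ⟨l, hl⟩ := hd (top j)
    have hl' := hl _ (hmem l)
    by_cases hlj : l = j
    · exact absurd hl' (not_le.mpr (h ▸ htop k l (by rw [hlj]; exact hjk)))
    · exact absurd hl' (not_le.mpr (htop j l hlj))
  rw [Finset.card_eq_two]
  refine ⟨top j, top k, htopne, ?_⟩
  ext y
  simp only [Finset.mem_filter, Finset.mem_univ, true_and, Finset.mem_insert,
    Finset.mem_singleton]
  refine ⟨fun ⟨hy, hdom⟩ => ?_, ?_⟩
  · obtain ⟨i, hi⟩ := hdom y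
    have hext' : ∀ x ∈ d, ∃ l, l ≠ i ∧ mn l = x ∧ u l x ≤ u l y := by
      intro x hx
      obtain ⟨l, hl⟩ := hdom x
      refine ⟨l, ?_, hmn l x hx fun z hz => hl z (Finset.mem_insert_of_mem hz),
        hl y (Finset.mem_insert_self _ _)⟩
      rintro rfl
      have hxy : x = y := hu l (le_antisymm (hl y (Finset.mem_insert_self _ _))
        (hi x (Finset.mem_insert_of_mem hx)))
      exact hy (hxy ▸ hx)
    have hinji := hinj i fun x hx => by
      obtain ⟨l, h1, h2, -⟩ := hext' x hx
      exact ⟨l, h1, h2⟩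
    have hyM : ∀ l, l ≠ i → u l (mn l) < u l y := by
      intro l hl
      obtain ⟨l', h1, h2, h3⟩ := hext' _ (hmem l)
      obtain rfl := hinji _ _ h1 hl h2
      exact lt_of_le_of_ne h3 fun h => hy (hu _ h ▸ hmem l')
    have hytop : y = top i := by
      refine hu i (le_antisymm (htopmax i y hyM) ?_)
      obtain ⟨l, hl⟩ := hdom (top i)
      by_cases h : l = i
      · exact h ▸ hl y (Finset.mem_insert_self _ _)
      · exact absurd (hl _ (Finset.mem_insert_of_mem (hmem l))) (not_le.mpr (htop i l h))
    by_cases hij : i = j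
    · exact Or.inl (hij ▸ hytop)
    by_cases hik : i = k
    · exact Or.inr (hik ▸ hytop)
    exact absurd (hinji j k (Ne.symm hij) (Ne.symm hik) hmjk) hjk
  · rintro (rfl | rfl)
    · exact hext j hsurjj
    · exact hext k hsurjk

/-- In a set with as many points as colors that misses a color, the number of points whose
removal leaves all colors but `i₀` is even. -/
theorem even_card_filter_image_erase (c : V → I) (i₀ : I) {r : Finset V}
    (hr : r.card = Fintype.card I) (hne : r.image c ≠ Finset.univ) :
    Even (r.filter fun x => (r.erase x).image c = Finset.univ.erase i₀).card := by
  rcases (r.filter fun x => (r.erase x).image c = Finset.univ.erase i₀).eq_empty_or_nonempty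
    with h | ⟨x₀, h⟩
  · simp [h]
  obtain ⟨hx₀, himg⟩ := Finset.mem_filter.mp h
  have hinj : Set.InjOn c (r.erase x₀ : Finset V) := by
    rw [← Finset.card_image_iff, himg, Finset.card_erase_of_mem (Finset.mem_univ _),
      Finset.card_erase_of_mem hx₀, hr, Finset.card_univ]
  have hne₀ : c x₀ ≠ i₀ := by
    intro h0
    apply hne
    rw [← Finset.insert_erase hx₀, Finset.image_insert, himg, h0,
      Finset.insert_erase (Finset.mem_univ _)]
  obtain ⟨x₁, hx₁, hc₁⟩ := Finset.mem_image.mp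
    (himg ▸ Finset.mem_erase.mpr ⟨hne₀, Finset.mem_univ _⟩ : c x₀ ∈ (r.erase x₀).image c)
  obtain ⟨h10, hx₁r⟩ := Finset.mem_erase.mp hx₁
  suffices (r.filter fun x => (r.erase x).image c = Finset.univ.erase i₀) = {x₀, x₁} by
    rw [this, Finset.card_pair h10.symm]; exact even_two
  ext x
  simp only [Finset.mem_filter, Finset.mem_insert, Finset.mem_singleton]
  constructor
  · rintro ⟨hx, hxi⟩
    by_contra! hcon
    have hxd : x ∈ r.erase x₀ := Finset.mem_erase.mpr ⟨hcon.1, hx⟩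
    have : c x ∈ (r.erase x).image c := by
      rw [hxi, ← himg]; exact Finset.mem_image_of_mem c hxd
    obtain ⟨z, hz, hzx⟩ := Finset.mem_image.mp this
    obtain ⟨hzne, hzr⟩ := Finset.mem_erase.mp hz
    by_cases hz0 : z = x₀
    · exact hcon.2 (hinj hxd hx₁ (by rw [hc₁, ← hzx, hz0]))
    · exact hzne (hinj (Finset.mem_erase.mpr ⟨hz0, hzr⟩) hxd hzx)
  · rintro (rfl | rfl)
    · exact ⟨hx₀, himg⟩
    · refine ⟨hx₁r, ?_⟩
      rw [← himg]
      ext i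
      simp only [Finset.mem_image, Finset.mem_erase]
      constructor
      · rintro ⟨z, ⟨hz, hzr⟩, rfl⟩
        by_cases hz0 : z = x₀
        · exact ⟨x, ⟨h10, hx₁r⟩, by rw [hc₁, hz0]⟩
        · exact ⟨z, ⟨hz0, hzr⟩, rfl⟩
      · rintro ⟨z, ⟨hz, hzr⟩, rfl⟩
        by_cases hz0 : z = x
        · exact ⟨x₀, ⟨h10.symm, hx₀⟩, by rw [hz0, hc₁]⟩
        · exact ⟨z, ⟨hz0, hzr⟩, rfl⟩

end Dominance

section Scarf

variable {T I α : Type*} [LinearOrder α] [Fintype T] [DecidableEq T] [Nonempty T]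
  [Fintype I] [DecidableEq I]

open Classical in
theorem card_extensions_slack_eq_one {u : I → T ⊕ I → α}
    (hu : ∀ i, Function.Injective (u i)) (hbot : ∀ i v, u i (Sum.inr i) ≤ u i v)
    (htop : ∀ i l x, l ≠ i → u l (Sum.inl x) < u l (Sum.inr i)) (i₀ : I)
    {d : Finset (T ⊕ I)} (hd : d = (Finset.univ.erase i₀).image Sum.inr) :
    (Finset.univ.filter fun y => y ∉ d ∧ Dominant u (insert y d)).card = 1 := by
  have hmem : ∀ l, l ≠ i₀ → Sum.inr l ∈ d := fun l hl => by simp [hd, hl]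
  have hlt : ∀ l x, u l (Sum.inr l) < u l (Sum.inl x) := fun l x =>
    lt_of_le_of_ne (hbot l _) fun h => by simpa using hu l h
  obtain ⟨m, -, hm⟩ := Finset.exists_max_image (Finset.univ : Finset T)
    (fun x => u i₀ (Sum.inl x)) Finset.univ_nonempty
  rw [Finset.card_eq_one]
  refine ⟨Sum.inl m, ?_⟩
  ext y
  simp only [Finset.mem_filter, Finset.mem_univ, true_and, Finset.mem_singleton]
  constructor
  · rintro ⟨hy, hdom⟩
    obtain ⟨l, hl⟩ := hdom (Sum.inl m)
    have hli : l = i₀ := by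
      by_contra h
      exact absurd (hl _ (Finset.mem_insert_of_mem (hmem l h))) (not_le.mpr (hlt l m))
    subst hli
    have hly := hl y (Finset.mem_insert_self _ _)
    rcases y with x | i
    · exact hu l (le_antisymm (hm x (Finset.mem_univ _)) hly)
    · by_cases h : i = l
      · exact absurd (h ▸ hly) (not_le.mpr (hlt l m))
      · exact absurd (hmem i h) hy
  · rintro rfl
    refine ⟨by simp [hd], fun z => ?_⟩
    rcases z with x | l
    · refine ⟨i₀, fun v hv => ?_⟩
      rcases Finset.mem_insert.mp hv with rfl | hv
      · exact hm x (Finset.mem_univ _)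
      · simp only [hd, Finset.mem_image, Finset.mem_erase, Finset.mem_univ, and_true] at hv
        obtain ⟨l, hl, rfl⟩ := hv
        exact (htop l i₀ x hl.symm).le
    · exact ⟨l, fun v _ => hbot l v⟩

open Classical in
/-- Scarf's lemma, in the form of a dual Sperner lemma: with slack points colored by their index,
there is a dominant set carrying every color. -/
theorem exists_dominant_rainbow [Nontrivial I] {u : I → T ⊕ I → α}
    (hu : ∀ i, Function.Injective (u i)) (hbot : ∀ i v, u i (Sum.inr i) ≤ u i v)
    (htop : ∀ i l x, l ≠ i → u l (Sum.inl x) < u l (Sum.inr i)) (c : T → I) :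
    ∃ S, Dominant u S ∧ S.image (Sum.elim c id) = Finset.univ := by
  by_contra! hcon
  obtain ⟨i₀⟩ := (inferInstance : Nonempty I)
  set c' : T ⊕ I → I := Sum.elim c id with hc'
  let A : Finset (Σ _ : Finset (T ⊕ I), T ⊕ I) :=
    (Finset.univ.filter fun r => r.card = Fintype.card I ∧ Dominant u r).sigma
      fun r => r.filter fun x => (r.erase x).image c' = Finset.univ.erase i₀
  let B : Finset (Σ _ : Finset (T ⊕ I), T ⊕ I) :=
    (Finset.univ.filter fun d => d.card + 1 = Fintype.card I ∧ Dominant u d ∧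
      d.image c' = Finset.univ.erase i₀).sigma
      fun d => Finset.univ.filter fun y => y ∉ d ∧ Dominant u (insert y d)
  have hAB : A.card = B.card := by
    refine Finset.card_bij' (fun p _ => ⟨p.1.erase p.2, p.2⟩) (fun p _ => ⟨insert p.2 p.1, p.2⟩)
      ?_ ?_ ?_ ?_
    · rintro ⟨r, x⟩ h
      simp only [A, B, Finset.mem_sigma, Finset.mem_filter, Finset.mem_univ, true_and] at h ⊢
      obtain ⟨⟨h1, h2⟩, h3, h4⟩ := h
      refine ⟨⟨?_, h2.mono (Finset.erase_subset _ _), h4⟩, Finset.notMem_erase _ _, ?_⟩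
      · rw [Finset.card_erase_add_one h3, h1]
      · rwa [Finset.insert_erase h3]
    · rintro ⟨d, y⟩ h
      simp only [A, B, Finset.mem_sigma, Finset.mem_filter, Finset.mem_univ, true_and] at h ⊢
      obtain ⟨⟨h1, h2, h3⟩, h4, h5⟩ := h
      refine ⟨⟨?_, h5⟩, Finset.mem_insert_self _ _, ?_⟩
      · rw [Finset.card_insert_of_notMem h4, h1]
      · rwa [Finset.erase_insert h4]
    · rintro ⟨r, x⟩ h
      simp only [A, Finset.mem_sigma, Finset.mem_filter] at h
      simp [Finset.insert_erase h.2.1]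
    · rintro ⟨d, y⟩ h
      simp only [B, Finset.mem_sigma, Finset.mem_filter] at h
      simp [Finset.erase_insert h.2.2.1]
  have hA : Even A.card := by
    rw [Finset.card_sigma]
    refine Finset.even_sum _ fun r hr => ?_
    obtain ⟨-, h1, h2⟩ := Finset.mem_filter.mp hr
    exact even_card_filter_image_erase c' i₀ h1 (hcon r h2)
  set d₀ : Finset (T ⊕ I) := (Finset.univ.erase i₀).image Sum.inr with hd₀
  have hB : Odd B.card := by
    rw [Finset.card_sigma, ← Finset.add_sum_erase _ _ (a := d₀)]
    · rw [card_extensions_slack_eq_one hu hbot htop i₀ hd₀]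
      refine Even.one_add (Finset.even_sum _ fun d hd => ?_)
      obtain ⟨hdne, hd⟩ := Finset.mem_erase.mp hd
      obtain ⟨-, hcard, hdom, himg⟩ := Finset.mem_filter.mp hd
      have hdn : d.Nonempty := by
        have := Fintype.one_lt_card (α := I)
        exact Finset.card_pos.mp (by omega)
      obtain ⟨x, hx⟩ : ∃ x, Sum.inl x ∈ d := by
        by_contra! hno
        apply hdne
        ext v
        rcases v with x | i
        · simp [hno x, hd₀]
        · have : i ∈ d.image c' ↔ Sum.inr i ∈ d := by
            rw [Finset.mem_image]
            constructor
            · rintro ⟨x | l, hv, rfl⟩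
              · exact absurd hv (hno x)
              · simpa [hc'] using hv
            · exact fun h => ⟨_, h, by simp [hc']⟩
          rw [← this, himg, hd₀]
          simp
      rw [hdom.card_extensions_eq_two hu hdn hcard fun i =>
        ⟨Sum.inr i, fun l hl => ⟨_, hx, htop i l x hl⟩⟩]
      exact even_two
    · refine Finset.mem_filter.mpr ⟨Finset.mem_univ _, ?_, ?_, ?_⟩
      · rw [hd₀, Finset.card_image_of_injective _ Sum.inr_injective,
          Finset.card_erase_add_one (Finset.mem_univ _), Finset.card_univ]
      · rintro (x | l)
        · refine ⟨i₀, fun v hv => ?_⟩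
          simp only [hd₀, Finset.mem_image, Finset.mem_erase, Finset.mem_univ, and_true] at hv
          obtain ⟨l, hl, rfl⟩ := hv
          exact (htop l i₀ x hl.symm).le
        · exact ⟨l, fun v _ => hbot l v⟩
      · rw [hd₀, Finset.image_image]
        simp [hc', Function.comp_def]
  exact Nat.not_even_iff_odd.mpr hB (hAB ▸ hA)

end Scarf

section DualKKM

variable {I : Type*} [Fintype I]

/-- For a coloring of the grid points of denominator `N` of a simplex, there are thresholds of
total above `N` that are met, up to one, by a point of each color whose threshold is nonzero. -/
theorem exists_grid_thresholds [Nontrivial I] (N : ℕ) (c : (I → ℕ) → I) :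
    ∃ m : I → ℕ, N < ∑ i, m i ∧
      ∀ i, m i = 0 ∨ ∃ x : I → ℕ, ∑ j, x j = N ∧ c x = i ∧ ∀ j, m j ≤ x j + 1 := by
  classical
  let T := {x : I → ℕ // x ∈ Finset.univ.piAntidiag N}
  have : Fintype T := inferInstanceAs (Fintype {x // x ∈ Finset.univ.piAntidiag N})
  have hT : ∀ x : I → ℕ, x ∈ (Finset.univ : Finset I).piAntidiag N ↔ ∑ j, x j = N := by
    simp [Finset.mem_piAntidiag]
  obtain ⟨k⟩ := (inferInstance : Nonempty I)
  have : Nonempty T := ⟨⟨Pi.single k N, by simp [hT]⟩⟩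
  let a : I → T ⊕ I → ℕ := fun i =>
    Sum.elim (fun x => x.1 i + 1) fun l => if i = l then 0 else N + 2
  let u : I → T ⊕ I → ℕ ×ₗ Fin (Fintype.card (T ⊕ I)) := fun i v =>
    toLex (a i v, Fintype.equivFin _ v)
  have hlt : ∀ i v w, a i v < a i w → u i v < u i w := fun i v w h =>
    Prod.Lex.toLex_lt_toLex.mpr (Or.inl h)
  have hle : ∀ i v w, u i v ≤ u i w → a i v ≤ a i w := fun i v w h =>
    not_lt.mp fun h' => absurd h (not_le.mpr (hlt i w v h'))
  obtain ⟨S, hdom, hS⟩ := exists_dominant_rainbow (u := u) (c := fun x => c x.1)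
    (fun i v w h => by simpa [u] using congrArg (fun p => (ofLex p).2) h)
    (fun i v => by
      by_cases h : v = Sum.inr i
      · rw [h]
      · refine (hlt _ _ _ ?_).le
        rcases v with x | l
        · simp [a]
        · have : i ≠ l := fun h' => h (by rw [h'])
          simp [a, this])
    (fun i l x h => hlt _ _ _ (by
      have hx : x.1 l ≤ N := by
        exact (Finset.single_le_sum (f := (x.1 : I → ℕ)) (fun _ _ => Nat.zero_le _)
          (Finset.mem_univ l)).trans_eq ((hT x.1).mp x.2)
      simp only [a, Sum.elim_inl, Sum.elim_inr, h, if_false]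
      omega))
  have hmemS : ∀ i, ∃ v ∈ S, Sum.elim (fun x : T => c x.1) id v = i := fun i =>
    Finset.mem_image.mp (hS.symm.subset (Finset.mem_univ i))
  have hSne : S.Nonempty := let ⟨v, hv, _⟩ := hmemS k; ⟨v, hv⟩
  choose w hw hmin using fun i => Finset.exists_min_image S (a i) hSne
  refine ⟨fun i => a i (w i), ?_, fun i => ?_⟩
  · by_contra! h
    let y : I → ℕ := fun i => a i (w i) + (Pi.single k (N - ∑ j, a j (w j)) : I → ℕ) i
    have hy : ∑ j, y j = N := by
      simp only [y, Finset.sum_add_distrib, Finset.sum_pi_single', Finset.mem_univ, if_true]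
      omega
    obtain ⟨i, hi⟩ := hdom (Sum.inl ⟨y, (hT y).mpr hy⟩)
    have := hle _ _ _ (hi _ (hw i))
    simp only [a, Sum.elim_inl, y] at this
    omega
  · obtain ⟨v, hv, hvi⟩ := hmemS i
    rcases v with x | l
    · exact Or.inr ⟨x.1, (hT _).mp x.2, hvi, fun j => hmin j _ hv⟩
    · left
      obtain rfl : l = i := hvi
      simpa [a] using hmin l _ hv

/-- A dual form of the Knaster–Kuratowski–Mazurkiewicz theorem: closed sets that cover the
standard simplex, each containing the face opposite to its vertex, have a common point. -/
theorem exists_mem_stdSimplex_forall_mem [Nontrivial I] {K : I → Set (I → ℝ)}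
    (hclosed : ∀ i, IsClosed (K i)) (hcover : ∀ z ∈ stdSimplex ℝ I, ∃ i, z ∈ K i)
    (hface : ∀ z ∈ stdSimplex ℝ I, ∀ i, z i = 0 → z ∈ K i) :
    ∃ z ∈ stdSimplex ℝ I, ∀ i, z ∈ K i := by
  classical
  have hgrid : ∀ (N : ℕ) (x : I → ℕ), ∑ j, x j = N + 1 →
      (fun j => (x j : ℝ) / (N + 1)) ∈ stdSimplex ℝ I := by
    intro N x hx
    refine ⟨fun j => by positivity, ?_⟩
    rw [← Finset.sum_div, ← Nat.cast_sum, hx]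
    push_cast
    exact div_self (by positivity)
  let L : I → Set (I → ℝ) := fun i => K i ∪ {z | z i = 0}
  have hL : ∀ i, IsClosed (L i) := fun i =>
    (hclosed i).union (isClosed_eq (continuous_apply i) continuous_const)
  have hLne : ∀ i, (L i).Nonempty := fun i => ⟨0, Or.inr rfl⟩
  have key : ∀ N : ℕ, ∃ z : I → ℝ, (∀ i, 0 ≤ z i) ∧ 1 ≤ ∑ i, z i ∧
      ∑ i, z i ≤ 1 + Fintype.card I / ((N : ℝ) + 1) ∧
      ∀ i, Metric.infDist z (L i) ≤ Fintype.card I / ((N : ℝ) + 1) := by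
    intro N
    have hN : (0 : ℝ) < N + 1 := by positivity
    choose! c hc using fun (x : I → ℕ) (hx : ∑ j, x j = N + 1) => hcover _ (hgrid N x hx)
    obtain ⟨m, hm, hmx⟩ := exists_grid_thresholds (N + 1) c
    have hsum : ∀ x : I → ℕ, (∑ j, x j = N + 1) → (∀ j, m j ≤ x j + 1) →
        ∑ j, (x j + 1 - m j) + ∑ j, m j = N + 1 + Fintype.card I := by
      intro x hx hle
      rw [← Finset.sum_add_distrib, Finset.sum_congr rfl fun j _ => Nat.sub_add_cancel (hle j),
        Finset.sum_add_distrib, hx]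
      simp
    refine ⟨fun j => (m j : ℝ) / (N + 1), fun i => by positivity, ?_, ?_, fun i => ?_⟩
    · rw [← Finset.sum_div, ← Nat.cast_sum, le_div_iff₀ hN]
      exact_mod_cast (by omega : 1 * (N + 1) ≤ ∑ j, m j)
    · obtain ⟨i, hi⟩ : ∃ i, m i ≠ 0 := by
        by_contra! h
        simp [h] at hm
      obtain ⟨x, hx, -, hle⟩ := (hmx i).resolve_left hi
      have := hsum x hx hle
      rw [← Finset.sum_div, ← Nat.cast_sum, div_le_iff₀ hN, add_mul, div_mul_cancel₀ _ hN.ne']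
      exact_mod_cast (by omega : ∑ j, m j ≤ 1 * (N + 1) + Fintype.card I)
    · rcases hmx i with h | ⟨x, hx, hxi, hle⟩
      · rw [Metric.infDist_zero_of_mem (Set.mem_union_right _ (by simp [h]))]
        positivity
      · refine (Metric.infDist_le_dist_of_mem (Set.mem_union_left _ (hxi ▸ hc x hx))).trans ?_
        rw [dist_pi_le_iff (by positivity)]
        intro j
        have h1 := hsum x hx hle
        have h2 : x j + 1 - m j ≤ ∑ j, (x j + 1 - m j) :=
          Finset.single_le_sum (f := fun j => x j + 1 - m j) (fun _ _ => Nat.zero_le _)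
            (Finset.mem_univ j)
        have h3 := hle j
        have h4 : (x j : ℝ) + 1 ≤ m j + Fintype.card I := by
          exact_mod_cast (by omega : x j + 1 ≤ m j + Fintype.card I)
        have h5 : (m j : ℝ) ≤ x j + 1 := by exact_mod_cast h3
        have h6 : (1 : ℝ) ≤ Fintype.card I := by
          exact_mod_cast Fintype.card_pos
        rw [Real.dist_eq, ← sub_div, abs_div, abs_of_pos hN]
        gcongr
        rw [abs_le]
        constructor <;> linarith
  choose z hz0 hz1 hz2 hzL using key
  have hlim : Filter.Tendsto (fun N : ℕ => (Fintype.card I : ℝ) / ((N : ℝ) + 1))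
      Filter.atTop (nhds 0) := by
    simpa [div_eq_mul_inv] using tendsto_one_div_add_atTop_nhds_zero_nat.const_mul
      (Fintype.card I : ℝ)
  have hbdd : ∀ N, z N ∈ Set.Icc (0 : I → ℝ) fun _ => 1 + Fintype.card I := by
    intro N
    refine ⟨hz0 N, fun i => ?_⟩
    refine (Finset.single_le_sum (f := z N) (fun j _ => hz0 N j) (Finset.mem_univ i)).trans
      ((hz2 N).trans ?_)
    exact (add_le_add_iff_left 1).mpr (div_le_self (by positivity)
      (by linarith [(Nat.cast_nonneg N : (0 : ℝ) ≤ N)]))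
  obtain ⟨y, -, φ, hφ, hy⟩ := isCompact_Icc.tendsto_subseq hbdd
  have hlimφ := hlim.comp hφ.tendsto_atTop
  have hcoord : ∀ i, Filter.Tendsto (fun N => z (φ N) i) Filter.atTop (nhds (y i)) := fun i =>
    ((continuous_apply i).tendsto y).comp hy
  have hsumlim : Filter.Tendsto (fun N => ∑ i, z (φ N) i) Filter.atTop (nhds (∑ i, y i)) :=
    tendsto_finsetSum _ fun i _ => hcoord i
  have hyS : y ∈ stdSimplex ℝ I := by
    refine ⟨fun i => ge_of_tendsto' (hcoord i) fun N => hz0 _ i, le_antisymm ?_ ?_⟩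
    · simpa using le_of_tendsto_of_tendsto' hsumlim (hlimφ.const_add 1) fun N => hz2 _
    · exact ge_of_tendsto' hsumlim fun N => hz1 _
  refine ⟨y, hyS, fun i => ?_⟩
  have hyL : y ∈ L i := by
    rw [(hL i).mem_iff_infDist_zero (hLne i)]
    refine le_antisymm ?_ Metric.infDist_nonneg
    exact le_of_tendsto_of_tendsto' (((Metric.continuous_infDist_pt (L i)).tendsto y).comp hy)
      hlimφ fun N => hzL _ i
  exact hyL.elim id (hface y hyS i)

end DualKKM

section ColumnSums

variable {ι : Type*} [Fintype ι] [DecidableEq ι]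

theorem diagonal_add_smul_mulVec_nonpos {d : ι → ℝ} {τ : ℝ} (hτ : 0 ≤ τ) {A : Matrix ι ι ℝ}
    (hA : ∀ i j, i ≠ j → A i j ≤ 0) {P : ι → ℝ} (hP : ∀ j, 0 ≤ P j) {k : ι} (hk : P k = 0) :
    ((Matrix.diagonal d + τ • A) *ᵥ P) k ≤ 0 := by
  rw [Matrix.mulVec, dotProduct]
  refine Finset.sum_nonpos fun j _ => ?_
  by_cases h : k = j
  · rw [← h, hk, mul_zero]
  · rw [Matrix.add_apply, Matrix.diagonal_apply_ne _ h, zero_add, Matrix.smul_apply, smul_eq_mul]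
    exact mul_nonpos_of_nonpos_of_nonneg (mul_nonpos_of_nonneg_of_nonpos hτ (hA k j h)) (hP j)

theorem sum_mul_le_sum_diagonal_add_smul_mulVec {d : ι → ℝ} {τ : ℝ} (hτ : 0 ≤ τ)
    {A : Matrix ι ι ℝ} (hA : ∀ j, 0 ≤ ∑ i, A i j) {P : ι → ℝ} (hP : ∀ j, 0 ≤ P j) :
    ∑ k, d k * P k ≤ ∑ k, ((Matrix.diagonal d + τ • A) *ᵥ P) k := by
  have h : ∑ k, (A *ᵥ P) k = ∑ j, (∑ i, A i j) * P j := by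
    simp only [Matrix.mulVec, dotProduct, Finset.sum_mul]
    exact Finset.sum_comm
  simp only [Matrix.add_mulVec, Matrix.smul_mulVec, Pi.add_apply, Pi.smul_apply,
    Matrix.mulVec_diagonal, smul_eq_mul, Finset.sum_add_distrib, ← Finset.mul_sum, h]
  exact le_add_of_nonneg_right
    (mul_nonneg hτ (Finset.sum_nonneg fun j _ => mul_nonneg (hA j) (hP j)))

end ColumnSums

/-- existence of a solution `P*` of the nonlinear discrete system
`(D + τ Ã(P*)) P* = F` with `0 < P*_k ≤ C_k`. -/
theorem existence_of_nonlinear_discrete_solution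
    (n : ℕ) (hn : 1 ≤ n) (d : Fin n → ℝ) (hd : ∀ k, 0 < d k)
    (τ : ℝ) (hτ : 0 < τ) (F : Fin n → ℝ) (hF : ∀ k, 0 < F k)
    (Atil : (Fin n → ℝ) → Matrix (Fin n) (Fin n) ℝ)
    (hcont : ContinuousOn Atil (box n fun k => (∑ j, F j) / d k))
    (hoff : ∀ P ∈ box n fun k => (∑ j, F j) / d k,
      ∀ i j, i ≠ j → Atil P i j ≤ 0)
    (hcol : ∀ P ∈ box n fun k => (∑ j, F j) / d k,
      ∀ j, 0 ≤ ∑ i, Atil P i j) :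
    ∃ Pstar ∈ box n fun k => (∑ j, F j) / d k,
      (Matrix.diagonal d + τ • Atil Pstar) *ᵥ Pstar = F ∧
      ∀ k, 0 < Pstar k := by
  have : Nonempty (Fin n) := ⟨⟨0, hn⟩⟩
  set M : ℝ := ∑ j, F j
  have hM : 0 ≤ M := Finset.sum_nonneg fun j _ => (hF j).le
  let Δ : Set (Option (Fin n) → ℝ) := stdSimplex ℝ (Option (Fin n))
  let p : (Option (Fin n) → ℝ) → Fin n → ℝ := fun z k => M * z (some k) / d k
  have hp : Continuous p := by fun_prop
  have hbox : ∀ z ∈ Δ, p z ∈ box n fun k => M / d k := fun z hz k => by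
    have h0 := hz.1 (some k)
    have h1 : z (some k) ≤ 1 := hz.2 ▸
      Finset.single_le_sum (fun j _ => hz.1 j) (Finset.mem_univ (some k))
    exact ⟨div_nonneg (mul_nonneg hM h0) (hd k).le,
      div_le_div_of_nonneg_right (mul_le_of_le_one_right hM h1) (hd k).le⟩
  let H : (Option (Fin n) → ℝ) → Fin n → ℝ := fun z =>
    (Matrix.diagonal d + τ • Atil (p z)) *ᵥ p z
  have hH : ContinuousOn H Δ := by
    have hA : ContinuousOn (fun z => Atil (p z)) Δ := hcont.comp hp.continuousOn hbox
    rw [continuousOn_iff_continuous_domRestrict] at hA ⊢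
    exact (continuous_const.add (hA.const_smul τ)).matrix_mulVec
      (hp.comp continuous_subtype_val)
  have hHface : ∀ z ∈ Δ, ∀ k, p z k = 0 → H z k ≤ 0 := fun z hz k hk =>
    diagonal_add_smul_mulVec_nonpos hτ.le (hoff _ (hbox z hz)) (fun j => (hbox z hz j).1) hk
  let K : Option (Fin n) → Set (Option (Fin n) → ℝ) := fun o =>
    o.elim (Δ ∩ {z | M ≤ ∑ k, H z k}) fun k => Δ ∩ {z | H z k ≤ F k}
  have hHk : ∀ k, ContinuousOn (fun z => H z k) Δ := fun k =>
    (continuous_apply k).comp_continuousOn hH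
  have hΔ : IsClosed Δ := isClosed_stdSimplex ℝ _
  obtain ⟨z, hz, hzK⟩ := exists_mem_stdSimplex_forall_mem (K := K)
    (fun o => by
      cases o with
      | none =>
        exact (continuousOn_finsetSum _ fun k _ => hHk k).preimage_isClosed_of_isClosed hΔ
          isClosed_Ici
      | some k => exact (hHk k).preimage_isClosed_of_isClosed hΔ isClosed_Iic)
    (fun z hz => by
      by_contra! h
      have h0 : ∑ k, H z k < M := lt_of_not_ge fun h' => h none ⟨hz, h'⟩
      refine h0.not_ge (Finset.sum_le_sum fun k _ => ?_)
      exact (lt_of_not_ge fun h' => h (some k) ⟨hz, h'⟩).le)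
    (fun z hz o ho => by
      cases o with
      | none =>
        refine ⟨hz, ?_⟩
        have h1 : ∑ k, z (some k) = 1 := by
          simpa [Fintype.sum_option, ho] using hz.2
        have h2 : ∑ k, d k * p z k = M := by
          rw [← mul_one M, ← h1, Finset.mul_sum]
          exact Finset.sum_congr rfl fun k _ => mul_div_cancel₀ _ (hd k).ne'
        exact h2.symm.trans_le (sum_mul_le_sum_diagonal_add_smul_mulVec hτ.le
          (hcol _ (hbox z hz)) fun j => (hbox z hz j).1)
      | some k => exact ⟨hz, (hHface z hz k (by simp [p, ho])).trans (hF k).le⟩)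
  have hle : ∀ k, H z k ≤ F k := fun k => (hzK (some k)).2
  have hsum : ∑ k, H z k = ∑ k, F k :=
    le_antisymm (Finset.sum_le_sum fun k _ => hle k) (hzK none).2
  have heq : ∀ k, H z k = F k := fun k =>
    (Finset.sum_eq_sum_iff_of_le fun k _ => hle k).mp hsum k (Finset.mem_univ k)
  refine ⟨p z, hbox z hz, funext heq, fun k => (hbox z hz k).1.lt_of_ne' fun h => ?_⟩
  exact (hF k).not_ge (heq k ▸ hHface z hz k h)
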